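/- The collection of sets U_s := {U : U is an ultrafilter in S with s ∈ U}, for s ∈ S, is a topological basis for the subspace topology that the patch topology on proper filters induces on the set of ultrafilters of S. -/

import Mathlib

/-- An inverse semigroup with zero: every element `a` has a unique `a⁻¹` with
`a * a⁻¹ * a = a` and `a⁻¹ * a * a⁻¹ = a⁻¹`, and `0` is absorbing. -/
class InvSemigroupWithZero (S : Type*) extends Semigroup S, Zero S, Inv S where
  mul_inv_mul : ∀ a : S, a * a⁻¹ * a = a
  inv_mul_inv : ∀ a : S, a⁻¹ * a * a⁻¹ = a⁻¹
  inv_unique : ∀ a b : S, a * b * a = a → b * a * b = b → b = a⁻¹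
  zero_mul : ∀ a : S, 0 * a = 0
  mul_zero : ∀ a : S, a * 0 = 0

namespace InvSemigroupWithZero

variable {S : Type*} [InvSemigroupWithZero S]

/-- The natural partial order on `S`: `a ≤ b` iff `a = a * a⁻¹ * b`. -/
def sle (a b : S) : Prop := a = a * a⁻¹ * b

/-- `↓s`, the down-set of `s` w.r.t. the natural partial order. -/
def dwn (s : S) : Set S := {t : S | sle t s}

/-- `↑A`, the up-set generated by `A` w.r.t. the natural partial order. -/
def up (A : Set S) : Set S := {b : S | ∃ a ∈ A, sle a b}

/-- A filter in `S`: a nonempty down-directed up-set. -/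
def IsFilt (F : Set S) : Prop :=
  F.Nonempty ∧ up F = F ∧ ∀ a ∈ F, ∀ b ∈ F, ∃ c ∈ F, sle c a ∧ sle c b

/-- A proper filter: a filter not containing `0`. -/
def IsPFilt (F : Set S) : Prop := IsFilt F ∧ (0 : S) ∉ F

/-- An ultrafilter: a proper filter maximal among proper filters. -/
def IsUltra (U : Set S) : Prop :=
  IsPFilt U ∧ ∀ G : Set S, IsPFilt G → U ⊆ G → U = G

/-- The set `E` of idempotents of `S`. -/
def E (S : Type*) [InvSemigroupWithZero S] : Set S := {e : S | e * e = e}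

/-- `F⁻¹ = {a⁻¹ : a ∈ F}`. -/
def finv (F : Set S) : Set S := (fun a : S => a⁻¹) '' F

/-- `F · G = ↑{fg : f ∈ F, g ∈ G}`. -/
def fmul (F G : Set S) : Set S := up (Set.image2 (· * ·) F G)

/-- The source `d(F) := F⁻¹ · F`. -/
def src (F : Set S) : Set S := fmul (finv F) F

/-- The range `r(F) := F · F⁻¹`. -/
def rng (F : Set S) : Set S := fmul F (finv F)

/-- The natural partial order on the idempotents: `e ≤ f` iff `e = e * f`. -/
def ele (e f : S) : Prop := e = e * f

/-- The down-set of an idempotent `e` inside `E`. -/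
def edwn (e : S) : Set S := {f : S | f ∈ E S ∧ ele f e}

/-- The up-set generated by `A` inside `E`. -/
def eup (A : Set S) : Set S := {f : S | f ∈ E S ∧ ∃ a ∈ A, ele a f}

/-- An `E`-filter: a proper filter of the inverse semigroup `E` of idempotents. -/
def IsEFilt (ξ : Set S) : Prop :=
  ξ ⊆ E S ∧ ξ.Nonempty ∧ eup ξ = ξ ∧
    (∀ a ∈ ξ, ∀ b ∈ ξ, ∃ c ∈ ξ, ele c a ∧ ele c b) ∧ (0 : S) ∉ ξ

/-- An `E`-ultrafilter: an `E`-filter maximal among `E`-filters. -/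
def IsEUltra (ξ : Set S) : Prop :=
  IsEFilt ξ ∧ ∀ η : Set S, IsEFilt η → ξ ⊆ η → ξ = η

/-- `β_s(ξ) = {f ∈ E : s·e·s⁻¹ ≤ f for some e ∈ ξ}`. -/
def beta (s : S) (ξ : Set S) : Set S :=
  {f : S | f ∈ E S ∧ ∃ e ∈ ξ, sle (s * e * s⁻¹) f}

/-- The set of proper filters in `S`. -/
abbrev PFilt (S : Type*) [InvSemigroupWithZero S] := {F : Set S // IsPFilt F}

/-- The patch topology on the set of proper filters, generated by the sets
`F(s;T) = {F : s ∈ F, F ∩ T = ∅}` for `s ∈ S` and finite `T ⊆ ↓s`. -/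
instance patchTopology : TopologicalSpace (PFilt S) :=
  TopologicalSpace.generateFrom
    {O : Set (PFilt S) | ∃ (s : S) (T : Set S), T.Finite ∧ T ⊆ dwn s ∧
      O = {F : PFilt S | s ∈ F.1 ∧ F.1 ∩ T = ∅}}

/-- The set of idempotent proper filters in `S`. -/
abbrev IPFilt (S : Type*) [InvSemigroupWithZero S] :=
  {F : Set S // IsPFilt F ∧ (F ∩ E S).Nonempty}

/-- The subspace topology induced by the patch topology on proper filters. -/
instance : TopologicalSpace (IPFilt S) :=
  TopologicalSpace.induced (fun F => (⟨F.1, F.2.1⟩ : PFilt S)) inferInstance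

/-- The set of `E`-filters. -/
abbrev EFilt (S : Type*) [InvSemigroupWithZero S] := {ξ : Set S // IsEFilt ξ}

/-- The patch topology on the set of `E`-filters, generated by the sets
`P(e;X) = {ξ : e ∈ ξ, ξ ∩ X = ∅}` for `e ∈ E` and finite `X ⊆ ↓e ∩ E`. -/
instance : TopologicalSpace (EFilt S) :=
  TopologicalSpace.generateFrom
    {O : Set (EFilt S) | ∃ (e : S) (X : Set S), e ∈ E S ∧ X.Finite ∧ X ⊆ edwn e ∧
      O = {ξ : EFilt S | e ∈ ξ.1 ∧ ξ.1 ∩ X = ∅}}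

/-- The set of ultrafilters in `S`. -/
abbrev UFilt (S : Type*) [InvSemigroupWithZero S] := {U : Set S // IsUltra U}

/-- The subspace topology induced by the patch topology on proper filters. -/
instance : TopologicalSpace (UFilt S) :=
  TopologicalSpace.induced (fun U => (⟨U.1, U.2.1⟩ : PFilt S)) inferInstance

end InvSemigroupWithZero

open InvSemigroupWithZero

namespace InvSemigroupWithZero

section Algebra

variable {S : Type*} [InvSemigroupWithZero S]

lemma mul_inv_mem_E (a : S) : a * a⁻¹ ∈ E S := by
  change a * a⁻¹ * (a * a⁻¹) = a * a⁻¹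
  rw [← mul_assoc, mul_inv_mul]

lemma inv_eq_self_of_mem_E {e : S} (he : e ∈ E S) : e⁻¹ = e := by
  have he' : e * e = e := he
  exact (inv_unique e e (by rw [he', he']) (by rw [he', he'])).symm

lemma mul_mem_E {e f : S} (he : e ∈ E S) (hf : f ∈ E S) : e * f ∈ E S := by
  have he' (z : S) : e * (e * z) = e * z := by rw [← mul_assoc, show e * e = e from he]
  have hf' (z : S) : f * (f * z) = f * z := by rw [← mul_assoc, show f * f = f from hf]
  have h₁ := mul_inv_mul (e * f)
  have h₂ := inv_mul_inv (e * f)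
  set x := (e * f)⁻¹ with hx
  have h₂' (z : S) : x * (e * (f * (x * z))) = x * z := by
    rw [← mul_assoc f, ← mul_assoc e, ← mul_assoc e, ← mul_assoc x, ← mul_assoc x, h₂]
  have hy : f * (x * e) = x := by
    apply inv_unique
    · simpa only [mul_assoc, he', hf'] using h₁
    · simp only [mul_assoc, he', hf', h₂']
  have hxx : x ∈ E S := by
    change x * x = x
    calc x * x = f * (x * e) * (f * (x * e)) := by rw [hy]
      _ = f * (x * e) := by simp only [mul_assoc, h₂']
      _ = x := hy
  rwa [inv_unique x (e * f) h₂ h₁, inv_eq_self_of_mem_E hxx]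

lemma mul_comm_of_mem_E {e f : S} (he : e ∈ E S) (hf : f ∈ E S) : e * f = f * e := by
  have he' (z : S) : e * (e * z) = e * z := by rw [← mul_assoc, show e * e = e from he]
  have hf' (z : S) : f * (f * z) = f * z := by rw [← mul_assoc, show f * f = f from hf]
  have hef : e * f * (e * f) = e * f := mul_mem_E he hf
  have hfe : f * e * (f * e) = f * e := mul_mem_E hf he
  rw [← inv_eq_self_of_mem_E (mul_mem_E he hf)]
  symm
  apply inv_unique
  · simpa only [mul_assoc, he', hf'] using hef
  · simpa only [mul_assoc, he', hf'] using hfe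

lemma mul_left_comm_of_mem_E {e f : S} (he : e ∈ E S) (hf : f ∈ E S) (a : S) :
    e * (f * a) = f * (e * a) := by
  rw [← mul_assoc, mul_comm_of_mem_E he hf, mul_assoc]

lemma mul_sle {f : S} (hf : f ∈ E S) (b : S) : sle (f * b) b := by
  have hf' : f * f = f := hf
  unfold sle
  have key : f * b * (f * b)⁻¹ * f = f * b * (f * b)⁻¹ := by
    rw [mul_comm_of_mem_E (mul_inv_mem_E _) hf, ← mul_assoc, ← mul_assoc, hf']
  conv_lhs => rw [← mul_inv_mul (f * b), ← mul_assoc _ f b, key]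

lemma sle_refl (a : S) : sle a a := (mul_inv_mul a).symm

lemma sle_trans {a b c : S} (hab : sle a b) (hbc : sle b c) : sle a c := by
  unfold sle at hab hbc
  have h : a = a * a⁻¹ * (b * b⁻¹) * c := by rw [mul_assoc _ (b * b⁻¹) c, ← hbc, ← hab]
  rw [h]
  exact mul_sle (mul_mem_E (mul_inv_mem_E a) (mul_inv_mem_E b)) c

lemma mul_sle_mul_left {e a b : S} (he : e ∈ E S) (h : sle a b) : sle (e * a) (e * b) := by
  unfold sle at h
  rw [h, mul_left_comm_of_mem_E he (mul_inv_mem_E a)]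
  exact mul_sle (mul_inv_mem_E a) _

lemma eq_zero_of_sle_zero {a : S} (h : sle a 0) : a = 0 := by
  unfold sle at h
  rwa [InvSemigroupWithZero.mul_zero] at h

end Algebra

section Filters

variable {S : Type*} [InvSemigroupWithZero S]

lemma IsFilt.mem_of_sle {F : Set S} (hF : IsFilt F) {a b : S} (ha : a ∈ F) (h : sle a b) :
    b ∈ F := by
  rw [← hF.2.1]
  exact ⟨a, ha, h⟩

/-- An ultrafilter omitting some `t` below one of its members has a member disjoint from `t`. -/
lemma IsUltra.exists_disjoint {U : Set S} (hU : IsUltra U) {s t : S} (hs : s ∈ U)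
    (hts : sle t s) (ht : t ∉ U) : ∃ u ∈ U, ∀ c, sle c u → sle c t → c = 0 := by
  by_contra! hne
  have he := mul_inv_mem_E t
  have htG : t ∈ up ((fun u => t * t⁻¹ * u) '' U) := ⟨t, ⟨s, hs, Eq.symm hts⟩, sle_refl t⟩
  apply ht
  have hG : IsPFilt (up ((fun u => t * t⁻¹ * u) '' U)) := by
    refine ⟨⟨⟨t, htG⟩, ?_, ?_⟩, ?_⟩
    · ext b
      constructor
      · rintro ⟨a, ⟨g, hg, hga⟩, hab⟩
        exact ⟨g, hg, sle_trans hga hab⟩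
      · intro hb
        exact ⟨b, hb, sle_refl b⟩
    · rintro a ⟨_, ⟨u, hu, rfl⟩, hua⟩ b ⟨_, ⟨v, hv, rfl⟩, hvb⟩
      obtain ⟨w, hw, hwu, hwv⟩ := hU.1.1.2.2 u hu v hv
      exact ⟨t * t⁻¹ * w, ⟨_, ⟨w, hw, rfl⟩, sle_refl _⟩,
        sle_trans (mul_sle_mul_left he hwu) hua, sle_trans (mul_sle_mul_left he hwv) hvb⟩
    · rintro ⟨_, ⟨u, hu, rfl⟩, hu0⟩
      obtain ⟨c, hcu, hct, hc⟩ := hne u hu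
      apply hc
      have hc₁ : t * t⁻¹ * c = c := by
        unfold sle at hct
        rw [hct, mul_left_comm_of_mem_E he (mul_inv_mem_E c), mul_inv_mul]
      have hc₂ := mul_sle_mul_left he hcu
      rw [hc₁] at hc₂
      exact eq_zero_of_sle_zero (sle_trans hc₂ hu0)
  rw [hU.2 _ hG fun u hu => ⟨_, ⟨u, hu, rfl⟩, mul_sle he u⟩]
  exact htG

lemma IsUltra.exists_disjoint_of_finite {U : Set S} (hU : IsUltra U) {s : S} (hs : s ∈ U)
    {T : Set S} (hT : T.Finite) (hTs : T ⊆ dwn s) (hUT : U ∩ T = ∅) :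
    ∃ u ∈ U, sle u s ∧ ∀ t ∈ T, ∀ c, sle c u → sle c t → c = 0 := by
  induction T, hT using Set.Finite.induction_on with
  | empty => exact ⟨s, hs, sle_refl s, by simp⟩
  | @insert t T _ _ ih =>
    rw [Set.insert_subset_iff] at hTs
    have ht : t ∉ U := fun h => (hUT ▸ ⟨h, Set.mem_insert t T⟩ : t ∈ (∅ : Set S))
    obtain ⟨u, hu, hus, huT⟩ := ih hTs.2 <| Set.subset_empty_iff.mp <|
      (Set.inter_subset_inter_right U (Set.subset_insert t T)).trans hUT.subset
    obtain ⟨v, hv, hvt⟩ := hU.exists_disjoint hs hTs.1 ht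
    obtain ⟨w, hw, hwu, hwv⟩ := hU.1.1.2.2 u hu v hv
    refine ⟨w, hw, sle_trans hwu hus, ?_⟩
    rintro x (rfl | hx) c hcw hcx
    · exact hvt c (sle_trans hcw hwv) hcx
    · exact huT x hx c (sle_trans hcw hwu) hcx

end Filters

end InvSemigroupWithZero

/-- The collection of sets `U_s = {U ultrafilter : s ∈ U}`, for `s ∈ S`,
is a topological basis for the subspace topology that the patch topology induces on the
set of ultrafilters. -/
theorem stmt_18 {S : Type*} [InvSemigroupWithZero S] :
    TopologicalSpace.IsTopologicalBasis
      {B : Set (UFilt S) | ∃ s : S, B = {U : UFilt S | s ∈ U.1}} := by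
  refine TopologicalSpace.isTopologicalBasis_of_isOpen_of_nhds ?_ ?_
  · rintro _ ⟨s, rfl⟩
    refine isOpen_induced_iff.mpr ⟨{F : PFilt S | s ∈ F.1 ∧ F.1 ∩ ∅ = ∅}, ?_, ?_⟩
    · exact .basic _ ⟨s, ∅, Set.finite_empty, Set.empty_subset _, rfl⟩
    · ext U
      simp
  · intro U O hUO hO
    obtain ⟨P, hP, rfl⟩ := isOpen_induced_iff.mp hO
    suffices h : ∃ s ∈ U.1, ∀ V : UFilt S, s ∈ V.1 → (⟨V.1, V.2.1⟩ : PFilt S) ∈ P by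
      obtain ⟨s, hs, hsP⟩ := h
      exact ⟨_, ⟨s, rfl⟩, hs, hsP⟩
    clear hO
    change TopologicalSpace.GenerateOpen _ P at hP
    induction hP with
    | basic P hP =>
      obtain ⟨s, T, hT, hTs, rfl⟩ := hP
      obtain ⟨hs, hUT⟩ := hUO
      obtain ⟨u, hu, hus, huT⟩ := U.2.exists_disjoint_of_finite hs hT hTs hUT
      refine ⟨u, hu, fun V huV => ⟨V.2.1.1.mem_of_sle huV hus, ?_⟩⟩
      refine Set.eq_empty_of_forall_notMem ?_
      rintro t ⟨htV, htT⟩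
      obtain ⟨c, hc, hcu, hct⟩ := V.2.1.1.2.2 u huV t htV
      exact V.2.1.2 (huT t htT c hcu hct ▸ hc)
    | univ =>
      obtain ⟨s, hs⟩ := U.2.1.1.1
      exact ⟨s, hs, fun _ _ => trivial⟩
    | inter P Q _ _ ihP ihQ =>
      obtain ⟨s, hs, hsP⟩ := ihP hUO.1
      obtain ⟨t, ht, htQ⟩ := ihQ hUO.2
      obtain ⟨c, hc, hcs, hct⟩ := U.2.1.1.2.2 s hs t ht
      exact ⟨c, hc, fun V hcV => ⟨hsP V (V.2.1.1.mem_of_sle hcV hcs),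
        htQ V (V.2.1.1.mem_of_sle hcV hct)⟩⟩
    | sUnion C _ ih =>
      obtain ⟨P, hP, hUP⟩ := hUO
      obtain ⟨s, hs, hsP⟩ := ih P hP hUP
      exact ⟨s, hs, fun V hV => ⟨P, hP, hsP V hV⟩⟩
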